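/- arXiv:2505.11338 — 3 statements merged into one kernel-verified Lean document; each statement's English description precedes it below -/
import Mathlib

section
/- For every λ > 0 and every real x < 0, one has ∫_x^∞ e^{−λ(y³ − x³)} dy ≤ 4/(3 λ x²). -/
theorem three_quarters_sq_mul_sub_le_cube_sub_cube {x y : ℝ} (h : x ≤ y) :
    3 / 4 * x ^ 2 * (y - x) ≤ y ^ 3 - x ^ 3 := by
  nlinarith [mul_nonneg (sub_nonneg.2 h) (sq_nonneg (y + x / 2))]

theorem stmt_6 (lam : ℝ) (hlam : 0 < lam) (x : ℝ) (hx : x < 0) :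
    ∫ y in Set.Ici x, Real.exp (-lam * (y ^ 3 - x ^ 3)) ≤ 4 / (3 * lam * x ^ 2) := by
  have hx2 : 0 < x ^ 2 := sq_pos_of_neg hx
  set b : ℝ := 3 / 4 * lam * x ^ 2 with hb
  have hbpos : 0 < b := mul_pos (mul_pos (by norm_num) hlam) hx2
  have hneg : -b < 0 := neg_lt_zero.2 hbpos
  rw [MeasureTheory.integral_Ici_eq_integral_Ioi]
  calc ∫ y in Set.Ioi x, Real.exp (-lam * (y ^ 3 - x ^ 3))
      ≤ ∫ y in Set.Ioi x, Real.exp (b * x) * Real.exp (-b * y) := by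
        refine MeasureTheory.integral_mono_of_nonneg
          (Filter.Eventually.of_forall fun y ↦ (Real.exp_pos _).le)
          ((integrableOn_exp_mul_Ioi hneg x).const_mul _) ?_
        filter_upwards [MeasureTheory.ae_restrict_mem measurableSet_Ioi] with y hy
        rw [← Real.exp_add, Real.exp_le_exp]
        have h := mul_le_mul_of_nonneg_left
          (three_quarters_sq_mul_sub_le_cube_sub_cube (le_of_lt hy)) hlam.le
        rw [hb]
        linarith
    _ = 1 / b := by
        rw [MeasureTheory.integral_const_mul, integral_exp_mul_Ioi hneg, neg_div_neg_eq,
          mul_div_assoc', ← Real.exp_add]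
        simp
    _ = 4 / (3 * lam * x ^ 2) := by
        rw [hb]
        field_simp
end

section
/- For every λ > 0 there exists a constant C > 0 such that for all x ∈ ℝ, ∫_x^∞ e^{−λ(y³ − x³)} dy ≤ C/(1 + x²). -/
theorem sub_mul_one_add_sq_sub_one_le {x y : ℝ} (h : x ≤ y) :
    (y - x) * (1 + x ^ 2) - 1 ≤ 8 * (y ^ 3 - x ^ 3) := by
  obtain ⟨t, rfl⟩ : ∃ t, y = x + t := ⟨y - x, by ring⟩
  have ht : 0 ≤ t := by linarith
  have hquad : t ^ 2 + x ^ 2 ≤ 8 * (t ^ 2 + 3 * x * t + 3 * x ^ 2) := by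
    nlinarith [sq_nonneg (7 * t + 12 * x), sq_nonneg x]
  have hcubic : t - 1 ≤ t ^ 3 := by
    nlinarith [mul_nonneg ht (sq_nonneg (t - 1)), sq_nonneg (t - 1)]
  nlinarith [mul_le_mul_of_nonneg_left hquad ht]

theorem stmt_7 (lam : ℝ) (hlam : 0 < lam) :
    ∃ C > 0, ∀ x : ℝ,
      ∫ y in Set.Ici x, Real.exp (-lam * (y ^ 3 - x ^ 3)) ≤ C / (1 + x ^ 2) := by
  refine ⟨8 * Real.exp (lam / 8) / lam, by positivity, fun x => ?_⟩
  set a : ℝ := -(lam / 8 * (1 + x ^ 2)) with ha_def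
  have ha : a < 0 := neg_neg_of_pos (by positivity)
  rw [MeasureTheory.integral_Ici_eq_integral_Ioi]
  calc ∫ y in Set.Ioi x, Real.exp (-lam * (y ^ 3 - x ^ 3))
      ≤ ∫ y in Set.Ioi x, Real.exp (lam / 8 - a * x) * Real.exp (a * y) := by
        refine MeasureTheory.integral_mono_of_nonneg (.of_forall fun _ => (Real.exp_pos _).le)
          ((integrableOn_exp_mul_Ioi ha x).const_mul _) ?_
        filter_upwards [MeasureTheory.ae_restrict_mem measurableSet_Ioi] with y hy
        rw [← Real.exp_add]
        apply Real.exp_le_exp.mpr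
        rw [ha_def]
        nlinarith [mul_le_mul_of_nonneg_left (sub_mul_one_add_sq_sub_one_le (le_of_lt hy)) hlam.le]
    _ = 8 * Real.exp (lam / 8) / lam / (1 + x ^ 2) := by
        rw [MeasureTheory.integral_const_mul, integral_exp_mul_Ioi ha, Real.exp_sub, ha_def]
        have := Real.exp_ne_zero (-(lam / 8 * (1 + x ^ 2)) * x)
        have : (1 + x ^ 2) ≠ 0 := by positivity
        field_simp
end

section
/- For all real numbers b > 0 and c₀ > 0 there exist constants a₀ > 0, μ₀ > 0, λ > 0 and C > 0 with the following property: for every h > 0, every μ with 0 < μ ≤ μ₀, and every differentiable function g : ℝ → ℝ such that for all t with |t| ≤ a₀ one has g′(t) = (1/(2h))(−b t² + μ + R(t)) for some function R satisfying |R(t)| ≤ c₀(μ² + μ t² + t⁴), the inequality −g(x) + g(y) ≤ (λ/h)(x³ − y³) + C μ^{3/2}/h holds for all x, y with x ≤ y and max(|x|, |y|) ≤ a₀. -/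
lemma mul_sub_mul_cube_le {k s d : ℝ} (hk : 0 < k) (hs : 0 ≤ s) (hd : 0 ≤ d) :
    s ^ 2 * d - k * d ^ 3 ≤ (1 + 1 / k) * s ^ 3 := by
  have hC : 0 < 1 + 1 / k := by positivity
  have hkC : 1 ≤ k * (1 + 1 / k) ^ 2 := by
    have h1 : k * (1 + 1 / k) ^ 2 = k + 2 + 1 / k := by field_simp; ring
    have h2 : 0 < 1 / k := by positivity
    linarith
  generalize 1 + 1 / k = C at hC hkC
  rcases le_total d (C * s) with hds | hds
  · have h1 : s ^ 2 * d ≤ s ^ 2 * (C * s) := by gcongr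
    have h2 : 0 ≤ k * d ^ 3 := by positivity
    linarith
  · have h1 : (C * s) ^ 2 ≤ d ^ 2 := by gcongr
    have h2 : s ^ 2 ≤ k * d ^ 2 := by
      calc s ^ 2 = 1 * s ^ 2 := (one_mul _).symm
        _ ≤ k * C ^ 2 * s ^ 2 := by gcongr
        _ = k * (C * s) ^ 2 := by ring
        _ ≤ k * d ^ 2 := by gcongr
    have h3 : s ^ 2 * d ≤ k * d ^ 2 * d := by gcongr
    have h4 : 0 ≤ C * s ^ 3 := by positivity
    linarith

/-- Theorem 3.2 of the paper, with the remainder `R` in the derivative of the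
phase `g` made explicit. -/
theorem stmt_8 (b c₀ : ℝ) (hb : 0 < b) (hc₀ : 0 < c₀) :
    ∃ a₀ > (0:ℝ), ∃ μ₀ > (0:ℝ), ∃ lam > (0:ℝ), ∃ C > (0:ℝ),
      ∀ h : ℝ, 0 < h → ∀ μ : ℝ, 0 < μ → μ ≤ μ₀ →
      ∀ g R : ℝ → ℝ, Differentiable ℝ g →
      (∀ t : ℝ, |t| ≤ a₀ → deriv g t = (1 / (2 * h)) * (-b * t ^ 2 + μ + R t)) →
      (∀ t : ℝ, |t| ≤ a₀ → |R t| ≤ c₀ * (μ ^ 2 + μ * t ^ 2 + t ^ 4)) →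
      ∀ x y : ℝ, x ≤ y → max |x| |y| ≤ a₀ →
        -g x + g y ≤ (lam / h) * (x ^ 3 - y ^ 3) + C * μ ^ ((3:ℝ)/2) / h := by
  refine ⟨√(b / (4 * c₀)), by positivity, min (b / (4 * c₀)) (1 / c₀), by positivity,
    b / 24, by positivity, 1 + 1 / (b / 96), by positivity, ?_⟩
  intro h hh μ hμ hμ₀ g R hg hg' hR x y hxy hmax
  set a := √(b / (4 * c₀)) with ha
  have ha2 : c₀ * a ^ 2 = b / 4 := by
    rw [ha, Real.sq_sqrt (by positivity)]; field_simp
  have hμb : c₀ * μ ≤ b / 4 := by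
    calc c₀ * μ ≤ c₀ * (b / (4 * c₀)) := by gcongr; exact hμ₀.trans (min_le_left _ _)
      _ = b / 4 := by field_simp
  have hμ1 : c₀ * μ ≤ 1 := by
    calc c₀ * μ ≤ c₀ * (1 / c₀) := by gcongr; exact hμ₀.trans (min_le_right _ _)
      _ = 1 := by field_simp
  have hbound : ∀ t, |t| ≤ a → -b * t ^ 2 + μ + R t + (b / 2 * t ^ 2 - 2 * μ) ≤ 0 := by
    intro t ht
    have h1 := (le_abs_self _).trans (hR t ht)
    have h2 : c₀ * t ^ 2 ≤ b / 4 := by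
      rw [← ha2, ← sq_abs t]; gcongr
    have h3 : c₀ * t ^ 2 * t ^ 2 ≤ b / 4 * t ^ 2 := by gcongr
    have h4 : c₀ * μ * t ^ 2 ≤ b / 4 * t ^ 2 := by gcongr
    have h5 : c₀ * μ * μ ≤ 1 * μ := by gcongr
    linarith
  have hderiv : ∀ t, HasDerivAt (fun t => g t + (b / 12 * t ^ 3 - μ * t) / h)
      (deriv g t + (b / 12 * (3 * t ^ 2) - μ) / h) t := by
    intro t
    have h1 : HasDerivAt (fun t : ℝ => b / 12 * t ^ 3 - μ * t) (b / 12 * (3 * t ^ 2) - μ) t := by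
      have h2 := ((hasDerivAt_pow 3 t).const_mul (b / 12)).sub ((hasDerivAt_id' t).const_mul μ)
      norm_num at h2
      exact h2
    exact (hg t).hasDerivAt.add (h1.div_const h)
  have hanti : AntitoneOn (fun t => g t + (b / 12 * t ^ 3 - μ * t) / h) (Set.Icc (-a) a) := by
    refine antitoneOn_of_deriv_nonpos (convex_Icc _ _)
      (fun t _ => (hderiv t).continuousAt.continuousWithinAt)
      (fun t _ => (hderiv t).differentiableAt.differentiableWithinAt) ?_
    intro t ht
    have htI : t ∈ Set.Icc (-a) a := interior_subset ht
    have hta : |t| ≤ a := abs_le.2 htI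
    rw [(hderiv t).deriv, hg' t hta]
    calc _ = 1 / (2 * h) * (-b * t ^ 2 + μ + R t + (b / 2 * t ^ 2 - 2 * μ)) := by
          field_simp; ring
      _ ≤ 0 := mul_nonpos_of_nonneg_of_nonpos (by positivity) (hbound t hta)
  have hF := hanti (abs_le.1 ((le_max_left _ _).trans hmax))
    (abs_le.1 ((le_max_right _ _).trans hmax)) hxy
  have hs2 : √μ ^ 2 = μ := Real.sq_sqrt hμ.le
  have hs3 : μ ^ ((3:ℝ)/2) = √μ ^ 3 := by
    rw [Real.sqrt_eq_rpow, ← Real.rpow_natCast, ← Real.rpow_mul hμ.le]; norm_num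
  have hcube := mul_sub_mul_cube_le (show 0 < b / 96 by positivity) (Real.sqrt_nonneg μ)
    (sub_nonneg.2 hxy)
  rw [hs2, ← hs3] at hcube
  have hdiff : (y - x) ^ 3 / 4 ≤ y ^ 3 - x ^ 3 := by
    nlinarith [mul_nonneg (sub_nonneg.2 hxy) (sq_nonneg (x + y))]
  have hnum : (μ * y - b / 12 * y ^ 3) - (μ * x - b / 12 * x ^ 3) ≤
      b / 24 * (x ^ 3 - y ^ 3) + (1 + 1 / (b / 96)) * μ ^ ((3:ℝ)/2) := by
    have := mul_le_mul_of_nonneg_left hdiff (show 0 ≤ b / 24 by positivity)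
    linarith
  calc -g x + g y ≤ ((μ * y - b / 12 * y ^ 3) - (μ * x - b / 12 * x ^ 3)) / h := by
        simp only [sub_div] at hF ⊢
        linarith
    _ ≤ (b / 24 * (x ^ 3 - y ^ 3) + (1 + 1 / (b / 96)) * μ ^ ((3:ℝ)/2)) / h := by gcongr
    _ = _ := by ring
end
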